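/- Consider the plant ẋ = Ax + Bu, y = Cᵀx with A ∈ ℝ^{n×n}, B ∈ ℝ^n, C ∈ ℝ^{n×l}, controlled by the passification-based adaptive output feedback u = θ(t)ᵀy, θ̇ = −Γ (gᵀy) y with Γ = Γᵀ ≻ 0 and g ∈ ℝ^l. Suppose there exist P = Pᵀ ≻ 0 and θ* ∈ ℝ^l satisfying the passification relations A_{θ*}ᵀP + P A_{θ*} ≺ 0 and PB = Cg, where A_θ := A + B θᵀ Cᵀ. Then along every solution of the closed-loop system, the function V(x,θ) = xᵀPx + (θ − θ*)ᵀΓ^{−1}(θ − θ*) satisfies V̇(t) = x(t)ᵀ(A_{θ*}ᵀP + P A_{θ*})x(t), which is strictly negative whenever x(t) ≠ 0; consequently every solution is bounded, and x(t) → 0 as t → ∞. -/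

import Mathlib

open scoped RealInnerProductSpace
open Matrix Set Filter

/-- Matrix-vector multiplication as a map between Euclidean spaces. -/
noncomputable def mvE {m n : ℕ} (A : Matrix (Fin m) (Fin n) ℝ) (v : EuclideanSpace ℝ (Fin n)) :
    EuclideanSpace ℝ (Fin m) := Matrix.toEuclideanLin A v

section mvE

variable {m n k : ℕ}

theorem mvE_add_vec (A : Matrix (Fin m) (Fin n) ℝ) (v w : EuclideanSpace ℝ (Fin n)) :
    mvE A (v + w) = mvE A v + mvE A w := map_add _ v w

theorem mvE_smul_vec (A : Matrix (Fin m) (Fin n) ℝ) (c : ℝ) (v : EuclideanSpace ℝ (Fin n)) :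
    mvE A (c • v) = c • mvE A v := map_smul _ c v

theorem mvE_add (A B : Matrix (Fin m) (Fin n) ℝ) (v : EuclideanSpace ℝ (Fin n)) :
    mvE (A + B) v = mvE A v + mvE B v := by
  simp [mvE]

theorem mvE_neg (A : Matrix (Fin m) (Fin n) ℝ) (v : EuclideanSpace ℝ (Fin n)) :
    mvE (-A) v = -mvE A v := by
  simp [mvE]

theorem mvE_mul (A : Matrix (Fin m) (Fin n) ℝ) (B : Matrix (Fin n) (Fin k) ℝ)
    (v : EuclideanSpace ℝ (Fin k)) : mvE (A * B) v = mvE A (mvE B v) := by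
  simp [mvE]

theorem mvE_one (v : EuclideanSpace ℝ (Fin n)) : mvE 1 v = v := by
  simp [mvE]

theorem inner_eq_dotProduct (v w : EuclideanSpace ℝ (Fin n)) :
    ⟪v, w⟫ = v.ofLp ⬝ᵥ w.ofLp := by
  rw [EuclideanSpace.inner_eq_star_dotProduct, star_trivial, dotProduct_comm]

theorem inner_mvE (A : Matrix (Fin m) (Fin n) ℝ) (v : EuclideanSpace ℝ (Fin m))
    (w : EuclideanSpace ℝ (Fin n)) : ⟪v, mvE A w⟫ = ⟪mvE Aᵀ v, w⟫ := by
  simp [inner_eq_dotProduct, mvE, Matrix.toLpLin_apply, Matrix.dotProduct_mulVec,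
    Matrix.mulVec_transpose]

theorem mvE_vecMulVec (b : EuclideanSpace ℝ (Fin m)) (c v : EuclideanSpace ℝ (Fin n)) :
    mvE (Matrix.vecMulVec b c) v = ⟪c, v⟫ • b := by
  ext i
  simp [inner_eq_dotProduct, mvE, Matrix.toLpLin_apply, Matrix.vecMulVec_mulVec]

theorem continuous_mvE (A : Matrix (Fin m) (Fin n) ℝ) : Continuous (mvE A) :=
  (LinearMap.toContinuousLinearMap (Matrix.toEuclideanLin A)).continuous

theorem norm_mvE_le (A : Matrix (Fin m) (Fin n) ℝ) :
    ∃ K, 0 ≤ K ∧ ∀ v, ‖mvE A v‖ ≤ K * ‖v‖ :=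
  ⟨_, norm_nonneg _, (LinearMap.toContinuousLinearMap (Matrix.toEuclideanLin A)).le_opNorm⟩

theorem HasDerivAt.mvE {v : ℝ → EuclideanSpace ℝ (Fin n)} {v' : EuclideanSpace ℝ (Fin n)} {t : ℝ}
    (hv : HasDerivAt v v' t) (A : Matrix (Fin m) (Fin n) ℝ) :
    HasDerivAt (fun s => _root_.mvE A (v s)) (_root_.mvE A v') t :=
  (LinearMap.toContinuousLinearMap (Matrix.toEuclideanLin A)).hasFDerivAt.comp_hasDerivAt t hv

/-- Derivative of a quadratic form with symmetric matrix along a curve. -/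
theorem HasDerivAt.inner_mvE_self {v : ℝ → EuclideanSpace ℝ (Fin n)}
    {v' : EuclideanSpace ℝ (Fin n)} {t : ℝ} (hv : HasDerivAt v v' t)
    {S : Matrix (Fin n) (Fin n) ℝ} (hS : Sᵀ = S) :
    HasDerivAt (fun s => ⟪v s, _root_.mvE S (v s)⟫) (2 * ⟪v t, _root_.mvE S v'⟫) t := by
  have h : ⟪v', _root_.mvE S (v t)⟫ = ⟪v t, _root_.mvE S v'⟫ := by
    rw [inner_mvE, hS, real_inner_comm]
  exact (hv.inner ℝ (hv.mvE S)).congr_deriv (by rw [h]; ring)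

/-- The quadratic form of a positive definite matrix is positive away from the origin. -/
theorem Matrix.PosDef.inner_mvE_pos {S : Matrix (Fin n) (Fin n) ℝ} (hS : S.PosDef)
    {v : EuclideanSpace ℝ (Fin n)} (hv : v ≠ 0) : 0 < ⟪v, mvE S v⟫ := by
  have h := hS.dotProduct_mulVec_pos (x := v.ofLp) (by simpa using hv)
  simpa [inner_eq_dotProduct, mvE, Matrix.toLpLin_apply] using h

/-- The quadratic form of a positive definite matrix is coercive. -/
theorem Matrix.PosDef.exists_le_inner_mvE {S : Matrix (Fin n) (Fin n) ℝ} (hS : S.PosDef) :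
    ∃ c, 0 < c ∧ ∀ v : EuclideanSpace ℝ (Fin n), c * ‖v‖ ^ 2 ≤ ⟪v, mvE S v⟫ := by
  rcases (Metric.sphere (0 : EuclideanSpace ℝ (Fin n)) 1).eq_empty_or_nonempty with h | h
  · refine ⟨1, one_pos, fun v => ?_⟩
    obtain rfl : v = 0 := by
      by_contra hv
      have : ‖v‖⁻¹ • v ∈ Metric.sphere (0 : EuclideanSpace ℝ (Fin n)) 1 := by
        simp [norm_smul, hv]
      simp [h] at this
    simp
  · obtain ⟨w, hw, hmin⟩ := (isCompact_sphere (0 : EuclideanSpace ℝ (Fin n)) 1).exists_isMinOn h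
      (continuous_id.inner (𝕜 := ℝ) (continuous_mvE S)).continuousOn
    have hw0 : w ≠ 0 := by
      rintro rfl
      simp at hw
    refine ⟨_, hS.inner_mvE_pos hw0, fun v => ?_⟩
    by_cases hv : v = 0
    · simp [hv]
    have hv' : ‖v‖ ≠ 0 := norm_ne_zero_iff.mpr hv
    have hmem : ‖v‖⁻¹ • v ∈ Metric.sphere (0 : EuclideanSpace ℝ (Fin n)) 1 := by
      simp [norm_smul, hv]
    have key : ⟪w, mvE S w⟫ ≤ ⟪‖v‖⁻¹ • v, mvE S (‖v‖⁻¹ • v)⟫ := hmin hmem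
    rw [mvE_smul_vec, real_inner_smul_left, real_inner_smul_right] at key
    calc ⟪w, mvE S w⟫ * ‖v‖ ^ 2
        ≤ (‖v‖⁻¹ * (‖v‖⁻¹ * ⟪v, mvE S v⟫)) * ‖v‖ ^ 2 := by gcongr
      _ = ⟪v, mvE S v⟫ := by field_simp

theorem norm_le_add_one_of_mul_sq_le {c r b : ℝ} (hc : 0 < c) (h : c * r ^ 2 ≤ b) :
    r ≤ b / c + 1 := by
  have : r ^ 2 ≤ b / c := by rw [le_div_iff₀ hc]; linarith
  nlinarith [sq_nonneg (r - 1)]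

end mvE

/-- If `V` is bounded below, `V' ≤ -c ‖x‖²` and `‖x'‖ ≤ K ‖x‖` on `[0, ∞)`, then `x → 0`. -/
theorem tendsto_zero_of_lyapunov {E : Type*} [NormedAddCommGroup E] [InnerProductSpace ℝ E]
    {x x' : ℝ → E} {V V' : ℝ → ℝ} {c K : ℝ} (hc : 0 < c)
    (hx : ∀ t, HasDerivAt x (x' t) t) (hx' : Continuous x')
    (hV : ∀ t, HasDerivAt V (V' t) t) (hVnonneg : ∀ t, 0 ≤ V t)
    (hVx : ∀ t, V' t ≤ -(c * ‖x t‖ ^ 2)) (hK : ∀ t, 0 ≤ t → ‖x' t‖ ≤ K * ‖x t‖) :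
    Tendsto x atTop (nhds 0) := by
  have hxc : Continuous x := continuous_iff_continuousAt.mpr fun t => (hx t).continuousAt
  have hnonpos : ∀ t, V' t ≤ 0 := fun t => (hVx t).trans (by simp; positivity)
  have hlim : Tendsto V atTop (nhds (⨅ t, V t)) :=
    tendsto_atTop_ciInf (antitone_of_hasDerivAt_nonpos hV hnonpos)
      ⟨0, by rintro _ ⟨t, rfl⟩; exact hVnonneg t⟩
  have hVint : MeasureTheory.IntegrableOn V' (Ioi 0) :=
    MeasureTheory.integrableOn_Ioi_deriv_of_nonpos' (fun t _ => hV t) (fun t _ => hnonpos t) hlim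
  have hsq : MeasureTheory.IntegrableOn (fun t => ‖x t‖ ^ 2) (Ioi 0) := by
    refine (hVint.const_mul (-c⁻¹)).mono' (by fun_prop) (Eventually.of_forall fun t => ?_)
    rw [Real.norm_of_nonneg (by positivity), neg_mul, ← mul_neg, inv_mul_eq_div, le_div_iff₀ hc]
    linarith [hVx t]
  have hsq' : MeasureTheory.IntegrableOn (fun t => 2 * ⟪x t, x' t⟫) (Ioi 0) := by
    refine (hsq.const_mul (2 * K)).mono' (by fun_prop) ?_
    filter_upwards [MeasureTheory.ae_restrict_mem measurableSet_Ioi] with t ht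
    rw [norm_mul, Real.norm_ofNat]
    have h1 : ‖⟪x t, x' t⟫‖ ≤ ‖x t‖ * ‖x' t‖ := norm_inner_le_norm _ _
    nlinarith [mul_le_mul_of_nonneg_left (hK t (le_of_lt ht)) (norm_nonneg (x t))]
  have hlim2 : Tendsto (fun t => ‖x t‖ ^ 2) atTop (nhds 0) :=
    MeasureTheory.tendsto_zero_of_hasDerivAt_of_integrableOn_Ioi (fun t _ => (hx t).norm_sq)
      hsq' hsq
  rw [tendsto_zero_iff_norm_tendsto_zero]
  simpa using hlim2.sqrt

/-- **Passification-based adaptive output feedback: Lyapunov decrease, boundedness and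
state convergence.** For the plant `ẋ = Ax + Bu`, `y = Cᵀx`, with adaptive output
feedback `u = θᵀy`, `θ̇ = −Γ(gᵀy)y` (`Γ ≻ 0`), if there exist `P ≻ 0` and `θ*` with
`A_{θ*}ᵀP + PA_{θ*} ≺ 0` and `PB = Cg` (where `A_θ = A + BθᵀCᵀ`), then
`V = xᵀPx + (θ−θ*)ᵀΓ⁻¹(θ−θ*)` satisfies `V̇ = xᵀ(A_{θ*}ᵀP + PA_{θ*})x < 0` for `x ≠ 0`;
every solution is (forward) bounded and `x(t) → 0`. -/
theorem passification_adaptive_output_feedback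
    (n l : ℕ) (A : Matrix (Fin n) (Fin n) ℝ) (B : EuclideanSpace ℝ (Fin n))
    (C : Matrix (Fin n) (Fin l) ℝ) (g : EuclideanSpace ℝ (Fin l))
    (Γ : Matrix (Fin l) (Fin l) ℝ) (hΓ : Γ.PosDef)
    (P : Matrix (Fin n) (Fin n) ℝ) (hP : P.PosDef)
    (θstar : EuclideanSpace ℝ (Fin l))
    (hNeg : (-((A + Matrix.vecMulVec B (mvE C θstar))ᵀ * P +
        P * (A + Matrix.vecMulVec B (mvE C θstar)))).PosDef)
    (hPB : mvE P B = mvE C g)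
    (x : ℝ → EuclideanSpace ℝ (Fin n)) (θ : ℝ → EuclideanSpace ℝ (Fin l))
    (hx : ∀ t : ℝ, HasDerivAt x
      (mvE A (x t) + (⟪θ t, mvE Cᵀ (x t)⟫ : ℝ) • B) t)
    (hθ : ∀ t : ℝ, HasDerivAt θ
      ((-(⟪g, mvE Cᵀ (x t)⟫ : ℝ)) • mvE Γ (mvE Cᵀ (x t))) t) :
    (∀ t : ℝ, HasDerivAt
        (fun s => ⟪x s, mvE P (x s)⟫ + ⟪θ s - θstar, mvE Γ⁻¹ (θ s - θstar)⟫)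
        (⟪x t, mvE ((A + Matrix.vecMulVec B (mvE C θstar))ᵀ * P +
            P * (A + Matrix.vecMulVec B (mvE C θstar))) (x t)⟫) t) ∧
      (∀ t : ℝ, x t ≠ 0 →
        (⟪x t, mvE ((A + Matrix.vecMulVec B (mvE C θstar))ᵀ * P +
            P * (A + Matrix.vecMulVec B (mvE C θstar))) (x t)⟫ : ℝ) < 0) ∧
      (∃ M : ℝ, ∀ t : ℝ, 0 ≤ t → ‖x t‖ ≤ M ∧ ‖θ t‖ ≤ M) ∧
      Tendsto x atTop (nhds 0) := by
  have hPt : Pᵀ = P := by simpa using hP.isHermitian.eq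
  have hΓit : (Γ⁻¹)ᵀ = Γ⁻¹ := by simpa using hΓ.inv.isHermitian.eq
  have hΓΓ : Γ⁻¹ * Γ = 1 := Matrix.nonsing_inv_mul _ ((Matrix.isUnit_iff_isUnit_det _).mp hΓ.isUnit)
  have hderiv : ∀ t : ℝ, HasDerivAt
      (fun s => ⟪x s, mvE P (x s)⟫ + ⟪θ s - θstar, mvE Γ⁻¹ (θ s - θstar)⟫)
      (⟪x t, mvE ((A + Matrix.vecMulVec B (mvE C θstar))ᵀ * P +
        P * (A + Matrix.vecMulVec B (mvE C θstar))) (x t)⟫) t := fun t => by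
    refine (((hx t).inner_mvE_self hPt).add
      (((hθ t).sub_const θstar).inner_mvE_self hΓit)).congr_deriv ?_
    have hsym : ∀ v w, ⟪mvE P v, w⟫ = ⟪v, mvE P w⟫ := fun v w => by rw [inner_mvE P, hPt]
    have hB : ⟪x t, mvE P B⟫ = ⟪g, mvE Cᵀ (x t)⟫ := by
      rw [hPB, inner_mvE, real_inner_comm]
    have hC : ⟪mvE C θstar, x t⟫ = ⟪θstar, mvE Cᵀ (x t)⟫ := by
      rw [inner_mvE Cᵀ, Matrix.transpose_transpose]
    have hT : ∀ M : Matrix (Fin n) (Fin n) ℝ,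
        ⟪x t, mvE (Mᵀ * P) (x t)⟫ = ⟪x t, mvE (P * M) (x t)⟫ := fun M => by
      rw [mvE_mul, mvE_mul, inner_mvE, Matrix.transpose_transpose, ← hsym, real_inner_comm]
    rw [mvE_add, inner_add_right, hT, mvE_mul, mvE_add, mvE_vecMulVec, mvE_smul_vec Γ⁻¹,
      ← mvE_mul, hΓΓ, mvE_one, mvE_add_vec, mvE_add_vec, mvE_smul_vec, mvE_smul_vec]
    simp only [inner_add_right, real_inner_smul_right, inner_sub_left, hB, hC]
    ring
  obtain ⟨cP, hcP, hPle⟩ := hP.exists_le_inner_mvE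
  obtain ⟨cΓ, hcΓ, hΓle⟩ := hΓ.inv.exists_le_inner_mvE
  obtain ⟨cN, hcN, hNle⟩ := hNeg.exists_le_inner_mvE
  simp only [mvE_neg, inner_neg_right] at hNle
  have hneg : ∀ t : ℝ, x t ≠ 0 →
      (⟪x t, mvE ((A + Matrix.vecMulVec B (mvE C θstar))ᵀ * P +
        P * (A + Matrix.vecMulVec B (mvE C θstar))) (x t)⟫ : ℝ) < 0 := fun t ht => by
    have h := hNeg.inner_mvE_pos ht
    rw [mvE_neg, inner_neg_right] at h
    linarith
  set V : ℝ → ℝ := fun s => ⟪x s, mvE P (x s)⟫ + ⟪θ s - θstar, mvE Γ⁻¹ (θ s - θstar)⟫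
  have hP0 : ∀ t, 0 ≤ cP * ‖x t‖ ^ 2 := fun t => by positivity
  have hΓ0 : ∀ t, 0 ≤ cΓ * ‖θ t - θstar‖ ^ 2 := fun t => by positivity
  have hVle : ∀ t, cP * ‖x t‖ ^ 2 + cΓ * ‖θ t - θstar‖ ^ 2 ≤ V t := fun t =>
    add_le_add (hPle _) (hΓle _)
  have hanti : Antitone V := antitone_of_hasDerivAt_nonpos hderiv fun t => by
    have : 0 ≤ cN * ‖x t‖ ^ 2 := by positivity
    exact (le_neg_of_le_neg (hNle (x t))).trans (neg_nonpos.mpr this)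
  have hxb : ∀ t, 0 ≤ t → ‖x t‖ ≤ V 0 / cP + 1 := fun t ht =>
    norm_le_add_one_of_mul_sq_le hcP (by linarith [hVle t, hΓ0 t, hanti ht])
  have hθb : ∀ t, 0 ≤ t → ‖θ t‖ ≤ V 0 / cΓ + 1 + ‖θstar‖ := fun t ht => by
    have h := norm_le_add_one_of_mul_sq_le hcΓ
      (show cΓ * ‖θ t - θstar‖ ^ 2 ≤ V 0 by linarith [hVle t, hP0 t, hanti ht])
    linarith [norm_sub_norm_le (θ t) θstar]
  refine ⟨hderiv, hneg, ⟨max (V 0 / cP + 1) (V 0 / cΓ + 1 + ‖θstar‖), fun t ht =>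
    ⟨(hxb t ht).trans (le_max_left _ _), (hθb t ht).trans (le_max_right _ _)⟩⟩, ?_⟩
  obtain ⟨KA, -, hKA⟩ := norm_mvE_le A
  obtain ⟨KC, hKC0, hKC⟩ := norm_mvE_le Cᵀ
  have hxc : Continuous x := continuous_iff_continuousAt.mpr fun t => (hx t).continuousAt
  have hθc : Continuous θ := continuous_iff_continuousAt.mpr fun t => (hθ t).continuousAt
  refine tendsto_zero_of_lyapunov (V := V) (c := cN)
    (K := KA + (V 0 / cΓ + 1 + ‖θstar‖) * KC * ‖B‖) hcN hx ?_ hderiv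
    (fun t => by linarith [hVle t, hP0 t, hΓ0 t]) (fun t => le_neg_of_le_neg (hNle (x t)))
    fun t ht => ?_
  · exact ((continuous_mvE A).comp hxc).add
      ((hθc.inner (𝕜 := ℝ) ((continuous_mvE Cᵀ).comp hxc)).smul continuous_const)
  · have hu : ‖⟪θ t, mvE Cᵀ (x t)⟫‖ ≤ (V 0 / cΓ + 1 + ‖θstar‖) * (KC * ‖x t‖) :=
      (norm_inner_le_norm _ _).trans
        (mul_le_mul (hθb t ht) (hKC _) (norm_nonneg _) ((norm_nonneg _).trans (hθb t ht)))
    calc ‖mvE A (x t) + (⟪θ t, mvE Cᵀ (x t)⟫ : ℝ) • B‖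
        ≤ ‖mvE A (x t)‖ + ‖⟪θ t, mvE Cᵀ (x t)⟫‖ * ‖B‖ := by
          rw [← norm_smul]
          exact norm_add_le _ _
      _ ≤ KA * ‖x t‖ + (V 0 / cΓ + 1 + ‖θstar‖) * (KC * ‖x t‖) * ‖B‖ :=
          add_le_add (hKA _) (mul_le_mul_of_nonneg_right hu (norm_nonneg _))
      _ = _ := by ring
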